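/- arXiv:1412.4527 — 3 statements merged into one kernel-verified Lean document; each statement's English description precedes it below -/
import Mathlib

section
/- Let T > 0, let c̄ > 0, κ > 0, e ∈ ℝ be constants, let f : ℝ → ℝ be continuously differentiable with f(x) > 0 for all x, and let ε, E : [0,T] → ℝ be absolutely continuous. Set q(t) := E(t)/f(ε(t)) and suppose P, U : [0,T] → ℝ are absolutely continuous functions satisfying the energy inequality q(t)·P'(t) − U'(t) ≥ 0 for a.e. t ∈ (0,T). Define σ(t) := c̄·ε(t) − e·E(t) + f'(ε(t))·U(t), D(t) := e·ε(t) + κ·E(t) + P(t), and F(t) := (c̄/2)·ε(t)² + (κ/2)·E(t)² + f(ε(t))·U(t). Then the dissipation inequality ε'(t)·σ(t) + D'(t)·E(t) − F'(t) ≥ 0 holds for a.e. t ∈ (0,T); in fact ε'(t)·σ(t) + D'(t)·E(t) − F'(t) = f(ε(t))·(q(t)·P'(t) − U'(t)). -/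
open MeasureTheory Set

/-- `q` is absolutely continuous on `[0,T]` with a.e. derivative `q'`,
encoded via the fundamental theorem of calculus. -/
def IsACOn (T : ℝ) (q q' : ℝ → ℝ) : Prop :=
  IntegrableOn q' (Icc 0 T) ∧ ∀ t ∈ Icc 0 T, q t = q 0 + ∫ τ in (0:ℝ)..t, q' τ

/-- `ξ` (with a.e. derivative `ξ'`) solves the play variational inequality
with threshold `r` and input `q` on `[0,T]`:
(i) `|q - ξ| ≤ r` on `[0,T]`, (ii) `ξ'(t)(q(t) - ξ(t) - r z) ≥ 0` for a.e. `t`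
and all `z ∈ [-1,1]`, (iii) `ξ(0) = max{q(0) - r, min{0, q(0) + r}}`. -/
def IsPlaySol (T r : ℝ) (q ξ ξ' : ℝ → ℝ) : Prop :=
  IsACOn T ξ ξ' ∧
  (∀ t ∈ Icc 0 T, |q t - ξ t| ≤ r) ∧
  (∀ᵐ t ∂(volume.restrict (Ioo 0 T)),
    ∀ z ∈ Icc (-1:ℝ) 1, ξ' t * (q t - ξ t - r * z) ≥ 0) ∧
  ξ 0 = max (q 0 - r) (min 0 (q 0 + r))

/-- An absolutely continuous function has its a.e. derivative as a genuine derivative a.e. -/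
lemma IsACOn.ae_hasDerivAt {T : ℝ} (hT : 0 ≤ T) {q q' : ℝ → ℝ} (h : IsACOn T q q') :
    ∀ᵐ t ∂(volume.restrict (Ioo 0 T)), HasDerivAt q (q' t) t := by
  have hint : IntervalIntegrable q' volume 0 T :=
    (intervalIntegrable_iff_integrableOn_Icc_of_le hT).2 h.1
  rw [ae_restrict_iff' measurableSet_Ioo]
  filter_upwards [hint.ae_hasDerivAt_integral] with t ht htT
  have hmem : t ∈ uIcc 0 T := by
    rw [uIcc_of_le hT]
    exact Ioo_subset_Icc_self htT
  refine ((ht hmem 0 left_mem_uIcc).const_add (q 0)).congr_of_eventuallyEq ?_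
  filter_upwards [Ioo_mem_nhds htT.1 htT.2] with s hs
  exact h.2 s (Ioo_subset_Icc_self hs)

/-- Thermodynamic consistency of the constitutive model: the hysteresis energy
inequality `q·P' - U' ≥ 0` implies the dissipation inequality
`ε'σ + D'E - F' ≥ 0`; in fact `ε'σ + D'E - F' = f(ε)·(q·P' - U')` a.e. -/
theorem stmt_15 (T cbar κ e : ℝ) (hT : 0 < T) (hcbar : 0 < cbar) (hκ : 0 < κ)
    (f : ℝ → ℝ) (hf : ContDiff ℝ 1 f) (hfpos : ∀ x, 0 < f x)
    (ε ε' E E' P P' U U' : ℝ → ℝ)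
    (hε : IsACOn T ε ε') (hE : IsACOn T E E')
    (hP : IsACOn T P P') (hU : IsACOn T U U')
    (q : ℝ → ℝ) (hq : ∀ t, q t = E t / f (ε t))
    (hen : ∀ᵐ t ∂(volume.restrict (Ioo 0 T)), q t * P' t - U' t ≥ 0)
    (σ D F : ℝ → ℝ)
    (hσ : ∀ t, σ t = cbar * ε t - e * E t + deriv f (ε t) * U t)
    (hD : ∀ t, D t = e * ε t + κ * E t + P t)
    (hF : ∀ t, F t = cbar / 2 * (ε t) ^ 2 + κ / 2 * (E t) ^ 2 + f (ε t) * U t) :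
    ∀ᵐ t ∂(volume.restrict (Ioo 0 T)), ∀ dD dF : ℝ,
      HasDerivAt D dD t → HasDerivAt F dF t →
        ε' t * σ t + dD * E t - dF ≥ 0 ∧
        ε' t * σ t + dD * E t - dF = f (ε t) * (q t * P' t - U' t) := by
  filter_upwards [hε.ae_hasDerivAt hT.le, hE.ae_hasDerivAt hT.le, hP.ae_hasDerivAt hT.le,
    hU.ae_hasDerivAt hT.le, hen] with t dε dE dP dU hent dD dF hdD hdF
  have df : HasDerivAt (fun s => f (ε s)) (deriv f (ε t) * ε' t) t :=
    ((hf.differentiable one_ne_zero) (ε t)).hasDerivAt.comp t dε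
  have hD' : dD = e * ε' t + κ * E' t + P' t := by
    rw [funext hD] at hdD
    exact hdD.unique (((dε.const_mul e).add (dE.const_mul κ)).add dP)
  have hF' : dF = cbar * ε t * ε' t + κ * E t * E' t
      + (deriv f (ε t) * ε' t * U t + f (ε t) * U' t) := by
    rw [funext hF] at hdF
    rw [hdF.unique ((((dε.pow 2).const_mul (cbar / 2)).add ((dE.pow 2).const_mul (κ / 2))).add
      (df.mul dU))]
    push_cast
    ring
  have hEq : E t = f (ε t) * q t := by
    rw [hq, mul_div_cancel₀ _ (hfpos _).ne']
  have key : ε' t * σ t + dD * E t - dF = f (ε t) * (q t * P' t - U' t) := by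
    rw [hD', hF', hσ]
    linear_combination P' t * hEq
  exact ⟨key ▸ mul_nonneg (hfpos _).le hent, key⟩
end

section
/- Let T > 0 and C > 0, let α : [0,T] → [0,∞) be absolutely continuous with α(0) = 0, and let β, δ : [0,T] → [0,∞) be integrable functions such that α'(t) + β(t) ≤ C·t·∫₀^t δ(τ) dτ for a.e. t ∈ (0,T). Then ∫₀^T e^{−Ct²} β(t) dt ≤ (1/2)·∫₀^T e^{−Ct²} δ(t) dt. -/
open MeasureTheory Set

/-- Integration by parts for the Gaussian weight `e^{-Ct²}` against the primitive of an
integrable function. -/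
lemma integral_exp_neg_mul_sq_mul {T C : ℝ} {g : ℝ → ℝ}
    (hg : IntervalIntegrable g volume 0 T) :
    ∫ t in (0:ℝ)..T, Real.exp (-C * t ^ 2) * g t =
      Real.exp (-C * T ^ 2) * (∫ τ in (0:ℝ)..T, g τ) +
        2 * ∫ t in (0:ℝ)..T, Real.exp (-C * t ^ 2) * (C * t * ∫ τ in (0:ℝ)..t, g τ) := by
  have hw : AbsolutelyContinuousOnInterval (fun t : ℝ ↦ Real.exp (-C * t ^ 2)) 0 T :=
    ContDiffOn.absolutelyContinuousOnInterval (by fun_prop)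
  have hG := hg.absolutelyContinuousOnInterval_intervalIntegral (c := 0) (by simp)
  have hderiv (t : ℝ) : deriv (fun t : ℝ ↦ Real.exp (-C * t ^ 2)) t =
      Real.exp (-C * t ^ 2) * (-C * (2 * t)) := by
    simpa using (((hasDerivAt_pow 2 t).const_mul (-C)).exp).deriv
  have hcongr : ∫ t in (0:ℝ)..T, Real.exp (-C * t ^ 2) * g t =
      ∫ t in (0:ℝ)..T, Real.exp (-C * t ^ 2) * deriv (fun x ↦ ∫ τ in (0:ℝ)..x, g τ) t := by
    apply intervalIntegral.integral_congr_ae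
    filter_upwards [hg.ae_hasDerivAt_integral] with t ht htT
    rw [(ht (uIoc_subset_uIcc htT) 0 (by simp)).deriv]
  rw [hcongr, hw.integral_mul_deriv_eq_deriv_mul hG, intervalIntegral.integral_same,
    mul_zero, sub_zero, sub_eq_add_neg,
    ← intervalIntegral.integral_neg, ← intervalIntegral.integral_const_mul (2 : ℝ)]
  congr 1
  refine intervalIntegral.integral_congr (E := ℝ) fun t _ ↦ ?_
  simp only [hderiv]
  ring

/-- The weighted-norm Gronwall-type estimate underlying the contraction argument:
if `α' + β ≤ C t ∫₀^t δ` a.e. with `α(0) = 0` and `α, β, δ ≥ 0`, then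
`∫₀^T e^{-Ct²} β ≤ (1/2) ∫₀^T e^{-Ct²} δ`. -/
theorem stmt_16 (T C : ℝ) (hT : 0 < T) (hC : 0 < C)
    (α α' β δ : ℝ → ℝ) (hα : IsACOn T α α') (hα0 : α 0 = 0)
    (hαnn : ∀ t ∈ Icc 0 T, 0 ≤ α t)
    (hβint : IntegrableOn β (Icc 0 T)) (hδint : IntegrableOn δ (Icc 0 T))
    (hβnn : ∀ t ∈ Icc 0 T, 0 ≤ β t) (hδnn : ∀ t ∈ Icc 0 T, 0 ≤ δ t)
    (hineq : ∀ᵐ t ∂(volume.restrict (Ioo 0 T)),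
      α' t + β t ≤ C * t * ∫ τ in (0:ℝ)..t, δ τ) :
    (∫ t in (0:ℝ)..T, Real.exp (-C * t ^ 2) * β t) ≤
      (1 / 2) * ∫ t in (0:ℝ)..T, Real.exp (-C * t ^ 2) * δ t := by
  obtain ⟨hα'int, hαeq⟩ := hα
  have toInterval {f : ℝ → ℝ} (hf : IntegrableOn f (Icc 0 T)) :
      IntervalIntegrable f volume 0 T :=
    (intervalIntegrable_iff_integrableOn_Icc_of_le hT.le).2 hf
  have hα' := toInterval hα'int
  have hβ := toInterval hβint
  have hδ := toInterval hδint
  have hw : ContinuousOn (fun t : ℝ ↦ Real.exp (-C * t ^ 2)) (uIcc 0 T) := by fun_prop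
  have hΔ : ContinuousOn (fun t ↦ ∫ τ in (0:ℝ)..t, δ τ) (uIcc 0 T) :=
    (hδ.absolutelyContinuousOnInterval_intervalIntegral (c := 0) (by simp)).continuousOn
  have hprim : ∀ t ∈ Icc 0 T, 0 ≤ ∫ τ in (0:ℝ)..t, α' τ := fun t ht ↦ by
    simpa [hαeq t ht, hα0] using hαnn t ht
  have hα'nonneg : 0 ≤ ∫ t in (0:ℝ)..T, Real.exp (-C * t ^ 2) * α' t := by
    rw [integral_exp_neg_mul_sq_mul hα']
    have h₁ := hprim T (right_mem_Icc.2 hT.le)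
    have h₂ : 0 ≤ ∫ t in (0:ℝ)..T,
        Real.exp (-C * t ^ 2) * (C * t * ∫ τ in (0:ℝ)..t, α' τ) :=
      intervalIntegral.integral_nonneg hT.le fun t ht ↦
        mul_nonneg (Real.exp_nonneg _) (mul_nonneg (mul_nonneg hC.le ht.1) (hprim t ht))
    positivity
  have hδparts := integral_exp_neg_mul_sq_mul (C := C) hδ
  have hδnonneg : 0 ≤ Real.exp (-C * T ^ 2) * ∫ τ in (0:ℝ)..T, δ τ :=
    mul_nonneg (Real.exp_nonneg _) (intervalIntegral.integral_nonneg hT.le hδnn)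
  have hmono : ∫ t in (0:ℝ)..T, Real.exp (-C * t ^ 2) * (α' t + β t) ≤
      ∫ t in (0:ℝ)..T, Real.exp (-C * t ^ 2) * (C * t * ∫ τ in (0:ℝ)..t, δ τ) := by
    refine intervalIntegral.integral_mono_ae_restrict hT.le
      ((hα'.add hβ).continuousOn_mul hw) (ContinuousOn.intervalIntegrable (by fun_prop)) ?_
    rw [← restrict_Ioo_eq_restrict_Icc]
    filter_upwards [hineq] with t ht
    exact mul_le_mul_of_nonneg_left ht (Real.exp_nonneg _)
  simp only [mul_add] at hmono
  rw [intervalIntegral.integral_add (hα'.continuousOn_mul hw) (hβ.continuousOn_mul hw)] at hmono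
  linarith
end

section
/- Let T > 0 and let g be a Preisach density with Lipschitz bound μ ∈ L¹(0,∞), M = ∫₀^∞ μ(r) dr, which additionally satisfies ∫₀^∞ (sup_{v∈ℝ} g(r,v) − inf_{v∈ℝ} g(r,v)) dr = M₁ < ∞. Let κ > 0, e ∈ ℝ, r ∈ C[0,T], and let f : ℝ → ℝ satisfy f(x) ≥ f₀ > 0 for all x, with x ↦ 1/f(x) Lipschitz continuous with constant L₁ and x ↦ x/f(x) Lipschitz continuous with constant L₂. Let ε₁, ε₂ ∈ C[0,T], let q₁, q₂ : [0,T] → ℝ be absolutely continuous, for i = 1,2 and each ρ > 0 let ξ_ρ^i be the solution of the play variational inequality with threshold ρ and input q_i, set P[q_i](t) := ∫₀^∞ g(ρ, ξ_ρ^i(t)) dρ, and suppose that q_i(t) + (1/(κ f(ε_i(t))))·P[q_i](t) = (r(t) − e·ε_i(t))/(κ f(ε_i(t))) for all t ∈ [0,T], i = 1,2. Then max_{t∈[0,T]} |q₁(t) − q₂(t)| ≤ exp(M/(κ f₀)) · (1/κ) · ((max_{t∈[0,T]}|r(t)| + M₁)·L₁ + |e|·L₂) · max_{t∈[0,T]}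 |ε₁(t) − ε₂(t)|. -/
open MeasureTheory Set

/-- `g : (0,∞) × ℝ → ℝ` is a Preisach density with Lipschitz bound `μ`:
`g` is measurable, `μ ∈ L¹(0,∞)`, and for a.e. `r > 0` one has `g(r,0) = 0`
and `v ↦ g(r,v)` is nondecreasing and Lipschitz with constant `μ(r) ≥ 0`. -/
def IsPreisachDensity (g : ℝ → ℝ → ℝ) (μ : ℝ → ℝ) : Prop :=
  Measurable (Function.uncurry g) ∧
  IntegrableOn μ (Ioi 0) ∧
  ∀ᵐ r ∂(volume.restrict (Ioi (0:ℝ))),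
    g r 0 = 0 ∧ 0 ≤ μ r ∧ Monotone (g r) ∧
      LipschitzWith (Real.toNNReal (μ r)) (g r)

open Filter Topology

namespace IsACOn

variable {T : ℝ} {x x' y y' : ℝ → ℝ}

lemma intervalIntegrable (h : IsACOn T x x') {s t : ℝ} (hs : s ∈ Icc 0 T) (ht : t ∈ Icc 0 T) :
    IntervalIntegrable x' volume s t :=
  (h.1.mono_set (uIcc_subset_Icc hs ht)).intervalIntegrable

lemma sub (hx : IsACOn T x x') (hy : IsACOn T y y') :
    IsACOn T (fun t => x t - y t) (fun t => x' t - y' t) := by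
  refine ⟨hx.1.sub hy.1, fun t ht => ?_⟩
  have h0 : (0 : ℝ) ∈ Icc 0 T := ⟨le_rfl, ht.1.trans ht.2⟩
  simp only
  rw [intervalIntegral.integral_sub (hx.intervalIntegrable h0 ht) (hy.intervalIntegrable h0 ht),
    hx.2 t ht, hy.2 t ht]
  ring

lemma eq_add_integral (h : IsACOn T x x') {s t : ℝ} (hs : s ∈ Icc 0 T) (ht : t ∈ Icc 0 T) :
    x t = x s + ∫ τ in s..t, x' τ := by
  have h0 : (0 : ℝ) ∈ Icc 0 T := ⟨le_rfl, ht.1.trans ht.2⟩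
  rw [h.2 t ht, h.2 s hs, add_assoc, intervalIntegral.integral_add_adjacent_intervals
    (h.intervalIntegrable h0 hs) (h.intervalIntegrable hs ht)]

lemma continuousOn (h : IsACOn T x x') : ContinuousOn x (Icc 0 T) := by
  rcases lt_or_ge T 0 with hT | hT
  · simp [Icc_eq_empty (not_le.mpr hT)]
  have hc : ContinuousOn (fun t => x 0 + ∫ τ in (0:ℝ)..t, x' τ) (Icc 0 T) := by
    refine continuousOn_const.add ?_
    rw [← uIcc_of_le hT]
    exact intervalIntegral.continuousOn_primitive_interval (by rw [uIcc_of_le hT]; exact h.1)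
  exact hc.congr h.2

/-- An absolutely continuous function that starts below `B` and does not increase while above `B`
stays below `B`. -/
lemma le_of_ae_deriv_nonpos (h : IsACOn T x x') {B : ℝ} (h0 : x 0 ≤ B)
    (hd : ∀ᵐ t ∂(volume.restrict (Ioo 0 T)), B < x t → x' t ≤ 0) :
    ∀ t ∈ Icc 0 T, x t ≤ B := by
  intro t ht
  by_contra! hlt
  let S := {s ∈ Icc 0 t | x s ≤ B}
  have hsub : Icc 0 t ⊆ Icc 0 T := Icc_subset_Icc_right ht.2
  have hScl : IsClosed S :=
    (h.continuousOn.mono hsub).preimage_isClosed_of_isClosed isClosed_Icc isClosed_Iic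
  have hSne : S.Nonempty := ⟨0, ⟨le_rfl, ht.1⟩, h0⟩
  have hSbdd : BddAbove S := ⟨t, fun s hs => hs.1.2⟩
  have hmem : sSup S ∈ S := hScl.csSup_mem hSne hSbdd
  set s := sSup S
  have hst : s ≤ t := hmem.1.2
  have hint : ∫ τ in s..t, x' τ ≤ 0 := by
    rw [intervalIntegral.integral_of_le hst, integral_Ioc_eq_integral_Ioo]
    refine integral_nonpos_of_ae ?_
    have hsub' : Ioo s t ⊆ Ioo 0 T := Ioo_subset_Ioo hmem.1.1 ht.2
    filter_upwards [ae_restrict_of_ae_restrict_of_subset hsub' hd,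
      ae_restrict_mem measurableSet_Ioo] with τ hτ hτm
    refine hτ (not_le.mp fun hle => ?_)
    exact (le_csSup hSbdd ⟨⟨hmem.1.1.trans hτm.1.le, hτm.2.le⟩, hle⟩).not_gt hτm.1
  have := h.eq_add_integral (hsub hmem.1) ht
  linarith [hmem.2]

end IsACOn

namespace IsPlaySol

lemma deriv_zero_or_boundary {a b d ρ : ℝ} (hρ : |a - b| ≤ ρ)
    (h : ∀ z ∈ Icc (-1 : ℝ) 1, d * (a - b - ρ * z) ≥ 0) :
    (0 < d → a - b = ρ) ∧ (d < 0 → a - b = -ρ) := by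
  have h1 := h 1 (by simp)
  have h2 := h (-1) (by simp)
  rw [abs_le] at hρ
  constructor <;> intro hd
  · have := nonneg_of_mul_nonneg_right h1 hd
    linarith
  · have := nonpos_of_mul_nonneg_right h2 hd
    linarith

variable {T ρ σ : ℝ} {q q₁ q₂ ξ η d d' : ℝ → ℝ}

lemma ae_boundary (h : IsPlaySol T ρ q ξ d) :
    ∀ᵐ t ∂(volume.restrict (Ioo 0 T)), t ∈ Icc 0 T ∧
      (0 < d t → q t - ξ t = ρ) ∧ (d t < 0 → q t - ξ t = -ρ) := by
  filter_upwards [h.2.2.1, ae_restrict_mem measurableSet_Ioo] with t ht hm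
  have hm' := Ioo_subset_Icc_self hm
  exact ⟨hm', deriv_zero_or_boundary (h.2.1 t hm') ht⟩

/-- Play outputs for the same input differ by at most the difference of the thresholds. -/
lemma abs_sub_le (hξ : IsPlaySol T ρ q ξ d) (hη : IsPlaySol T σ q η d') (hσ : 0 < σ)
    (hσρ : σ ≤ ρ) : ∀ t ∈ Icc 0 T, |ξ t - η t| ≤ ρ - σ := by
  have key : (∀ t ∈ Icc 0 T, ξ t - η t ≤ ρ - σ) ∧ ∀ t ∈ Icc 0 T, η t - ξ t ≤ ρ - σ := by
    constructor
    · refine (hξ.1.sub hη.1).le_of_ae_deriv_nonpos ?_ ?_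
      · rw [hξ.2.2.2, hη.2.2.2]; grind
      · filter_upwards [hξ.ae_boundary, hη.ae_boundary] with t h1 h2 hlt
        have h3 := abs_le.mp (hξ.2.1 t h1.1)
        have h4 := abs_le.mp (hη.2.1 t h1.1)
        by_contra! hpos
        rcases lt_or_ge 0 (d t) with h | h
        · linarith [h1.2.1 h]
        · linarith [h2.2.2 (by linarith)]
    · refine (hη.1.sub hξ.1).le_of_ae_deriv_nonpos ?_ ?_
      · rw [hξ.2.2.2, hη.2.2.2]; grind
      · filter_upwards [hξ.ae_boundary, hη.ae_boundary] with t h1 h2 hlt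
        have h3 := abs_le.mp (hξ.2.1 t h1.1)
        have h4 := abs_le.mp (hη.2.1 t h1.1)
        by_contra! hpos
        rcases lt_or_ge (d t) 0 with h | h
        · linarith [h1.2.2 h]
        · linarith [h2.2.1 (by linarith)]
  intro t ht
  exact abs_le.mpr ⟨by linarith [key.2 t ht], key.1 t ht⟩

/-- To bound `ξ₁ - ξ₂` from above it suffices to do so at times at which the input difference and
the output differences for all smaller thresholds dominate it. -/
lemma sub_le_of_dominated {ξ₁ ξ₂ : ℝ → ℝ → ℝ}
    (h₁ : ∀ ρ : ℝ, 0 < ρ → ∃ d, IsPlaySol T ρ q₁ (ξ₁ ρ) d)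
    (h₂ : ∀ ρ : ℝ, 0 < ρ → ∃ d, IsPlaySol T ρ q₂ (ξ₂ ρ) d) (hρ : 0 < ρ) {B : ℝ} (hB : 0 ≤ B)
    (hT : 0 ≤ T)
    (h : ∀ t ∈ Icc 0 T, 0 < ξ₁ ρ t - ξ₂ ρ t → ξ₁ ρ t - ξ₂ ρ t ≤ q₁ t - q₂ t →
      (∀ σ, 0 < σ → σ ≤ ρ → ξ₁ ρ t - ξ₂ ρ t ≤ ξ₁ σ t - ξ₂ σ t) → ξ₁ ρ t - ξ₂ ρ t ≤ B) :
    ∀ t ∈ Icc 0 T, ξ₁ ρ t - ξ₂ ρ t ≤ B := by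
  obtain ⟨d₁, hd₁⟩ := h₁ ρ hρ
  obtain ⟨d₂, hd₂⟩ := h₂ ρ hρ
  refine (hd₁.1.sub hd₂.1).le_of_ae_deriv_nonpos ?_ ?_
  · by_contra! hlt
    have key : ∀ σ, 0 < σ → σ ≤ ρ → ξ₁ ρ 0 - ξ₂ ρ 0 ≤ ξ₁ σ 0 - ξ₂ σ 0 := by
      intro σ hσ hσρ
      obtain ⟨e₁, he₁⟩ := h₁ σ hσ
      obtain ⟨e₂, he₂⟩ := h₂ σ hσ
      rw [hd₁.2.2.2, hd₂.2.2.2] at hlt ⊢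
      rw [he₁.2.2.2, he₂.2.2.2]
      grind
    refine hlt.not_ge (h 0 ⟨le_rfl, hT⟩ (hB.trans_lt hlt) ?_ key)
    rw [hd₁.2.2.2, hd₂.2.2.2] at hlt ⊢
    grind
  · filter_upwards [hd₁.ae_boundary, hd₂.ae_boundary] with t b1 b2 hlt
    by_contra! hpos
    have c1 := abs_le.mp (hd₁.2.1 t b1.1)
    have c2 := abs_le.mp (hd₂.2.1 t b1.1)
    have hcase : q₁ t - ξ₁ ρ t = ρ ∨ q₂ t - ξ₂ ρ t = -ρ := by
      rcases lt_or_ge 0 (d₁ t) with h | h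
      · exact Or.inl (b1.2.1 h)
      · exact Or.inr (b2.2.2 (by linarith))
    refine hlt.not_ge (h t b1.1 (hB.trans_lt hlt) ?_ fun σ hσ hσρ => ?_)
    · rcases hcase with h | h <;> linarith
    · obtain ⟨e₁, he₁⟩ := h₁ σ hσ
      obtain ⟨e₂, he₂⟩ := h₂ σ hσ
      have f1 := abs_le.mp (hd₁.abs_sub_le he₁ hσ hσρ t b1.1)
      have f2 := abs_le.mp (hd₂.abs_sub_le he₂ hσ hσρ t b1.1)
      have g1 := abs_le.mp (he₁.2.1 t b1.1)
      have g2 := abs_le.mp (he₂.2.1 t b1.1)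
      rcases hcase with h | h <;> linarith

end IsPlaySol

/-- The weight `exp (∫_x^∞ ν)` for `x ≥ 0`. -/
noncomputable def expTail (ν : ℝ → ℝ) (x : ℝ) : ℝ :=
  Real.exp ((∫ s in Ioi (0:ℝ), ν s) - ∫ s in (0:ℝ)..x, ν s)

section expTail

variable {ν : ℝ → ℝ}

lemma expTail_antitone (hν : Integrable ν) (h0 : ∀ x, 0 ≤ ν x) : Antitone (expTail ν) := by
  intro a b hab
  refine Real.exp_le_exp.mpr (sub_le_sub_left ?_ _)
  have := intervalIntegral.integral_nonneg hab (fun x _ => h0 x) (μ := volume)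
  rw [← intervalIntegral.integral_add_adjacent_intervals (hν.intervalIntegrable (a := 0) (b := a))
    (hν.intervalIntegrable (a := a) (b := b))]
  linarith

lemma expTail_le (hν : Integrable ν) (h0 : ∀ x, 0 ≤ ν x) {x : ℝ} (hx : 0 ≤ x) :
    expTail ν x ≤ Real.exp (∫ s in Ioi (0:ℝ), ν s) := by
  simpa [expTail] using expTail_antitone hν h0 hx

lemma one_le_expTail (hν : Integrable ν) (h0 : ∀ x, 0 ≤ ν x) {x : ℝ} (hx : 0 ≤ x) :
    1 ≤ expTail ν x := by
  refine Real.one_le_exp (sub_nonneg.mpr ?_)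
  rw [intervalIntegral.integral_of_le hx]
  exact setIntegral_mono_set hν.integrableOn (Eventually.of_forall h0)
    Ioc_subset_Ioi_self.eventuallyLE

lemma integrableOn_mul_expTail (hν : Integrable ν) (h0 : ∀ x, 0 ≤ ν x) {a : ℝ} (ha : 0 ≤ a) :
    IntegrableOn (fun s => ν s * expTail ν s) (Ioi a) := by
  refine Integrable.mul_bdd (c := Real.exp (∫ s in Ioi (0:ℝ), ν s)) hν.integrableOn
    (expTail_antitone hν h0).measurable.aestronglyMeasurable ?_
  filter_upwards [ae_restrict_mem measurableSet_Ioi] with x hx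
  have hpos : 0 ≤ expTail ν x := Real.exp_nonneg _
  rw [Real.norm_of_nonneg hpos]
  exact expTail_le hν h0 (ha.trans (mem_Ioi.mp hx).le)

lemma integral_mul_expTail_le (hν : Integrable ν) (h0 : ∀ x, 0 ≤ ν x) {a : ℝ} (ha : 0 ≤ a) :
    ∫ s in Ioi a, ν s * expTail ν s ≤ expTail ν a - 1 := by
  refine le_of_tendsto (intervalIntegral_tendsto_integral_Ioi a
    (integrableOn_mul_expTail hν h0 ha) tendsto_id) ?_
  filter_upwards [eventually_ge_atTop a] with b hab
  have hmono : Monotone (fun x => -expTail ν x) := (expTail_antitone hν h0).neg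
  have hderiv : ∀ᵐ x, ν x * expTail ν x = deriv (fun x => -expTail ν x) x := by
    filter_upwards [LocallyIntegrable.ae_hasDerivAt_integral hν.locallyIntegrable] with x hx
    have := (((hx 0).const_sub (∫ s in Ioi (0:ℝ), ν s)).exp).neg.deriv
    refine Eq.trans ?_ this.symm
    simp only [expTail]
    ring
  rw [id, intervalIntegral.integral_congr_ae (hderiv.mono fun x hx _ => hx)]
  have := (hmono.monotoneOn (uIcc a b)).intervalIntegral_deriv_mem_uIcc
  rw [uIcc_of_le (by linarith [hmono hab])] at this
  linarith [this.2, one_le_expTail hν h0 (ha.trans hab)]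

end expTail

section Comparison

variable {T H W : ℝ} {q₁ q₂ w ν : ℝ → ℝ} {g ξ ξ₁ ξ₂ : ℝ → ℝ → ℝ}

lemma IsPlaySol.continuousOn_threshold {q : ℝ → ℝ}
    (h : ∀ ρ : ℝ, 0 < ρ → ∃ d, IsPlaySol T ρ q (ξ ρ) d) {t : ℝ} (ht : t ∈ Icc 0 T) :
    ContinuousOn (fun ρ => ξ ρ t) (Ioi 0) := by
  refine LipschitzOnWith.continuousOn (K := 1) (LipschitzOnWith.of_dist_le_mul ?_)
  intro a ha b hb
  obtain ⟨d, hd⟩ := h a ha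
  obtain ⟨d', hd'⟩ := h b hb
  rw [NNReal.coe_one, one_mul, Real.dist_eq, Real.dist_eq]
  rcases le_total a b with hab | hab
  · rw [abs_sub_comm, abs_sub_comm a]
    exact (hd'.abs_sub_le hd ha hab t ht).trans (le_abs_self _)
  · exact (hd.abs_sub_le hd' hb hab t ht).trans (le_abs_self _)

lemma abs_le_oscillation {φ : ℝ → ℝ} (h0 : φ 0 = 0) (ha : BddAbove (range φ))
    (hb : BddBelow (range φ)) (v : ℝ) : |φ v| ≤ sSup (range φ) - sInf (range φ) := by
  have h1 := le_csSup ha (mem_range_self v)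
  have h2 := csInf_le hb (mem_range_self v)
  have h3 := le_csSup ha (mem_range_self 0)
  have h4 := csInf_le hb (mem_range_self 0)
  rw [h0] at h3 h4
  exact abs_le.mpr ⟨by linarith, by linarith⟩

lemma ae_abs_le_oscillation {μ : ℝ → ℝ} (hg : IsPreisachDensity g μ)
    (hgbdd : ∀ᵐ ρ ∂(volume.restrict (Ioi (0:ℝ))),
      BddAbove (range (g ρ)) ∧ BddBelow (range (g ρ))) (φ : ℝ → ℝ) :
    ∀ᵐ ρ ∂(volume.restrict (Ioi (0:ℝ))),
      |g ρ (φ ρ)| ≤ sSup (range (g ρ)) - sInf (range (g ρ)) := by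
  filter_upwards [hg.2.2, hgbdd] with ρ h1 h2
  exact abs_le_oscillation h1.1 h2.1 h2.2 _

lemma IsPreisachDensity.integrableOn_comp {μ φ : ℝ → ℝ} (hg : IsPreisachDensity g μ)
    (hgbdd : ∀ᵐ ρ ∂(volume.restrict (Ioi (0:ℝ))),
      BddAbove (range (g ρ)) ∧ BddBelow (range (g ρ)))
    (hoscint : IntegrableOn (fun ρ => sSup (range (g ρ)) - sInf (range (g ρ))) (Ioi 0))
    (hφ : ContinuousOn φ (Ioi 0)) : IntegrableOn (fun ρ => g ρ (φ ρ)) (Ioi 0) := by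
  refine Integrable.mono' hoscint ?_ (ae_abs_le_oscillation hg hgbdd φ)
  exact (hg.1.comp_aemeasurable
    (aemeasurable_id.prodMk (hφ.aemeasurable measurableSet_Ioi))).aestronglyMeasurable

/-- One step of the Gronwall-type iteration in the threshold variable. -/
lemma play_sub_le_of_abs_le (hT : 0 ≤ T)
    (h₁ : ∀ ρ : ℝ, 0 < ρ → ∃ d, IsPlaySol T ρ q₁ (ξ₁ ρ) d)
    (h₂ : ∀ ρ : ℝ, 0 < ρ → ∃ d, IsPlaySol T ρ q₂ (ξ₂ ρ) d)
    (hν : Integrable ν) (hν0 : ∀ x, 0 ≤ ν x)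
    (hg : ∀ᵐ ρ ∂(volume.restrict (Ioi (0:ℝ))),
      Monotone (g ρ) ∧ ∀ u v, W * |g ρ u - g ρ v| ≤ ν ρ * |u - v|)
    (hi₁ : ∀ t ∈ Icc 0 T, IntegrableOn (fun ρ => g ρ (ξ₁ ρ t)) (Ioi 0))
    (hi₂ : ∀ t ∈ Icc 0 T, IntegrableOn (fun ρ => g ρ (ξ₂ ρ t)) (Ioi 0))
    (hw : ∀ t ∈ Icc 0 T, 0 ≤ w t ∧ w t ≤ W)
    (heq : ∀ t ∈ Icc 0 T, q₁ t - q₂ t +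
      w t * ((∫ ρ in Ioi (0:ℝ), g ρ (ξ₁ ρ t)) - ∫ ρ in Ioi (0:ℝ), g ρ (ξ₂ ρ t)) ≤ H)
    (hH : 0 ≤ H) {N : ℝ} (hN0 : 0 ≤ N)
    (hN : ∀ ρ, 0 < ρ → ∀ t ∈ Icc 0 T, |ξ₁ ρ t - ξ₂ ρ t| ≤ N * expTail ν ρ)
    {ρ : ℝ} (hρ : 0 < ρ) :
    ∀ t ∈ Icc 0 T, ξ₁ ρ t - ξ₂ ρ t ≤ H + N * (expTail ν ρ - 1) := by
  have hE := one_le_expTail hν hν0 hρ.le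
  refine IsPlaySol.sub_le_of_dominated h₁ h₂ hρ
    (add_nonneg hH (mul_nonneg hN0 (by linarith))) hT ?_
  intro t ht hpos hp hdom
  have hint : IntegrableOn (fun s => N * (ν s * expTail ν s)) (Ioi ρ) :=
    (integrableOn_mul_expTail hν hν0 hρ.le).const_mul N
  have hlow : -(∫ s in Ioi ρ, N * (ν s * expTail ν s)) ≤
      w t * ((∫ s in Ioi (0:ℝ), g s (ξ₁ s t)) - ∫ s in Ioi (0:ℝ), g s (ξ₂ s t)) := by
    rw [← integral_sub (hi₁ t ht) (hi₂ t ht), ← integral_const_mul, ← integral_neg,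
      ← inter_eq_self_of_subset_right (Ioi_subset_Ioi hρ.le),
      ← setIntegral_indicator measurableSet_Ioi]
    refine integral_mono_ae ?_ (((hi₁ t ht).sub (hi₂ t ht)).const_mul _) ?_
    · exact ((integrable_indicator_iff measurableSet_Ioi).mpr hint.neg).integrableOn
    filter_upwards [hg, ae_restrict_mem measurableSet_Ioi] with s hs hs0
    rcases le_or_gt s ρ with hsρ | hsρ
    · rw [indicator_of_notMem (by simpa using hsρ)]
      exact mul_nonneg (hw t ht).1 (sub_nonneg.mpr (hs.1 (by linarith [hdom s hs0 hsρ])))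
    · rw [indicator_of_mem (mem_Ioi.mpr hsρ)]
      have e1 := neg_abs_le (g s (ξ₁ s t) - g s (ξ₂ s t))
      have e2 := mul_le_mul_of_nonneg_left e1 (hw t ht).1
      have e3 := mul_le_mul_of_nonneg_right (hw t ht).2 (abs_nonneg (g s (ξ₁ s t) - g s (ξ₂ s t)))
      have e4 := hs.2 (ξ₁ s t) (ξ₂ s t)
      have e5 := mul_le_mul_of_nonneg_left (hN s hs0 t ht) (hν0 s)
      linarith
  rw [integral_const_mul] at hlow
  have := mul_le_mul_of_nonneg_left (integral_mul_expTail_le hν hν0 hρ.le) hN0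
  linarith [heq t ht]

lemma play_abs_sub_le_of_abs_le (hT : 0 ≤ T)
    (h₁ : ∀ ρ : ℝ, 0 < ρ → ∃ d, IsPlaySol T ρ q₁ (ξ₁ ρ) d)
    (h₂ : ∀ ρ : ℝ, 0 < ρ → ∃ d, IsPlaySol T ρ q₂ (ξ₂ ρ) d)
    (hν : Integrable ν) (hν0 : ∀ x, 0 ≤ ν x)
    (hg : ∀ᵐ ρ ∂(volume.restrict (Ioi (0:ℝ))),
      Monotone (g ρ) ∧ ∀ u v, W * |g ρ u - g ρ v| ≤ ν ρ * |u - v|)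
    (hi₁ : ∀ t ∈ Icc 0 T, IntegrableOn (fun ρ => g ρ (ξ₁ ρ t)) (Ioi 0))
    (hi₂ : ∀ t ∈ Icc 0 T, IntegrableOn (fun ρ => g ρ (ξ₂ ρ t)) (Ioi 0))
    (hw : ∀ t ∈ Icc 0 T, 0 ≤ w t ∧ w t ≤ W)
    (heq : ∀ t ∈ Icc 0 T, |q₁ t - q₂ t +
      w t * ((∫ ρ in Ioi (0:ℝ), g ρ (ξ₁ ρ t)) - ∫ ρ in Ioi (0:ℝ), g ρ (ξ₂ ρ t))| ≤ H)
    (hH : 0 ≤ H) {N : ℝ} (hN0 : 0 ≤ N)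
    (hN : ∀ ρ, 0 < ρ → ∀ t ∈ Icc 0 T, |ξ₁ ρ t - ξ₂ ρ t| ≤ N * expTail ν ρ)
    {ρ : ℝ} (hρ : 0 < ρ) :
    ∀ t ∈ Icc 0 T, |ξ₁ ρ t - ξ₂ ρ t| ≤ H + N * (expTail ν ρ - 1) := by
  intro t ht
  refine abs_sub_le_iff.mpr ⟨?_, ?_⟩
  · exact play_sub_le_of_abs_le hT h₁ h₂ hν hν0 hg hi₁ hi₂ hw
      (fun t ht => (abs_le.mp (heq t ht)).2) hH hN0 hN hρ t ht
  · refine play_sub_le_of_abs_le hT h₂ h₁ hν hν0 hg hi₂ hi₁ hw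
      (fun t ht => ?_) hH hN0 (fun σ hσ t ht => abs_sub_comm (ξ₂ σ t) _ ▸ hN σ hσ t ht) hρ t ht
    linarith [(abs_le.mp (heq t ht)).1]

lemma play_abs_sub_le_of_input {C : ℝ} (hT : 0 ≤ T)
    (h₁ : ∀ ρ : ℝ, 0 < ρ → ∃ d, IsPlaySol T ρ q₁ (ξ₁ ρ) d)
    (h₂ : ∀ ρ : ℝ, 0 < ρ → ∃ d, IsPlaySol T ρ q₂ (ξ₂ ρ) d)
    (hC : ∀ t ∈ Icc 0 T, |q₁ t - q₂ t| ≤ C) {ρ : ℝ} (hρ : 0 < ρ) :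
    ∀ t ∈ Icc 0 T, |ξ₁ ρ t - ξ₂ ρ t| ≤ C := by
  have hC0 : 0 ≤ C := (abs_nonneg _).trans (hC 0 ⟨le_rfl, hT⟩)
  intro t ht
  refine abs_sub_le_iff.mpr ⟨?_, ?_⟩
  · exact IsPlaySol.sub_le_of_dominated h₁ h₂ hρ hC0 hT
      (fun s hs _ hp _ => hp.trans (abs_sub_le_iff.mp (hC s hs)).1) t ht
  · exact IsPlaySol.sub_le_of_dominated h₂ h₁ hρ hC0 hT
      (fun s hs _ hp _ => hp.trans (abs_sub_le_iff.mp (hC s hs)).2) t ht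

/-- Gronwall-type estimate in the threshold variable. -/
lemma play_abs_sub_le_mul_expTail (hT : 0 ≤ T) {C : ℝ}
    (hC : ∀ t ∈ Icc 0 T, |q₁ t - q₂ t| ≤ C)
    (h₁ : ∀ ρ : ℝ, 0 < ρ → ∃ d, IsPlaySol T ρ q₁ (ξ₁ ρ) d)
    (h₂ : ∀ ρ : ℝ, 0 < ρ → ∃ d, IsPlaySol T ρ q₂ (ξ₂ ρ) d)
    (hν : Integrable ν) (hν0 : ∀ x, 0 ≤ ν x)
    (hg : ∀ᵐ ρ ∂(volume.restrict (Ioi (0:ℝ))),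
      Monotone (g ρ) ∧ ∀ u v, W * |g ρ u - g ρ v| ≤ ν ρ * |u - v|)
    (hi₁ : ∀ t ∈ Icc 0 T, IntegrableOn (fun ρ => g ρ (ξ₁ ρ t)) (Ioi 0))
    (hi₂ : ∀ t ∈ Icc 0 T, IntegrableOn (fun ρ => g ρ (ξ₂ ρ t)) (Ioi 0))
    (hw : ∀ t ∈ Icc 0 T, 0 ≤ w t ∧ w t ≤ W)
    (heq : ∀ t ∈ Icc 0 T, |q₁ t - q₂ t +
      w t * ((∫ ρ in Ioi (0:ℝ), g ρ (ξ₁ ρ t)) - ∫ ρ in Ioi (0:ℝ), g ρ (ξ₂ ρ t))| ≤ H)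
    {ρ : ℝ} (hρ : 0 < ρ) {t : ℝ} (ht : t ∈ Icc 0 T) :
    |ξ₁ ρ t - ξ₂ ρ t| ≤ H * expTail ν ρ := by
  have h0 : (0 : ℝ) ∈ Icc 0 T := ⟨le_rfl, hT⟩
  have hH : 0 ≤ H := (abs_nonneg _).trans (heq 0 h0)
  let S : Set ℝ := {y | ∃ ρ, 0 < ρ ∧ ∃ t ∈ Icc 0 T, y = |ξ₁ ρ t - ξ₂ ρ t| / expTail ν ρ}
  have hEpos : ∀ σ, 0 < expTail ν σ := fun σ => Real.exp_pos _
  have hbdd : BddAbove S := by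
    refine ⟨C, ?_⟩
    rintro _ ⟨σ, hσ, s, hs, rfl⟩
    exact (div_le_self (abs_nonneg _) (one_le_expTail hν hν0 hσ.le)).trans
      (play_abs_sub_le_of_input hT h₁ h₂ hC hσ s hs)
  have hne : S.Nonempty := ⟨_, 1, one_pos, 0, h0, rfl⟩
  set N := sSup S
  have hN : ∀ σ, 0 < σ → ∀ s ∈ Icc 0 T, |ξ₁ σ s - ξ₂ σ s| ≤ N * expTail ν σ :=
    fun σ hσ s hs => (div_le_iff₀ (hEpos σ)).mp (le_csSup hbdd ⟨σ, hσ, s, hs, rfl⟩)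
  have hN0 : 0 ≤ N := Real.sSup_nonneg (by
    rintro _ ⟨σ, -, s, -, rfl⟩
    exact div_nonneg (abs_nonneg _) (hEpos σ).le)
  have hNH : N ≤ H := by
    by_contra! hlt
    set E := Real.exp (∫ s in Ioi (0:ℝ), ν s)
    have hE : 0 < E := Real.exp_pos _
    have hle : N ≤ N - (N - H) / E := by
      refine csSup_le hne ?_
      rintro _ ⟨σ, hσ, s, hs, rfl⟩
      have h3 := play_abs_sub_le_of_abs_le hT h₁ h₂ hν hν0 hg hi₁ hi₂ hw heq hH hN0 hN hσ s hs
      have h4 : (N - H) / E * expTail ν σ ≤ N - H := by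
        rw [div_mul_eq_mul_div, div_le_iff₀ hE]
        exact mul_le_mul_of_nonneg_left (expTail_le hν hν0 hσ.le) (by linarith)
      rw [div_le_iff₀ (hEpos σ)]
      linarith
    have : 0 < (N - H) / E := div_pos (by linarith) hE
    linarith
  exact (hN ρ hρ t ht).trans (mul_le_mul_of_nonneg_right hNH (hEpos ρ).le)

end Comparison

lemma abs_le_iSup_Icc {a b : ℝ} {φ : ℝ → ℝ} (hφ : ContinuousOn φ (Icc a b)) {t : ℝ}
    (ht : t ∈ Icc a b) : |φ t| ≤ ⨆ s : Icc a b, |φ s| := by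
  have hb : BddAbove (range fun s : Icc a b => |φ s|) :=
    isCompact_range (continuousOn_iff_continuous_domRestrict.mp hφ.abs) |>.bddAbove
  exact le_ciSup hb ⟨t, ht⟩

/-- Lipschitz continuity of the strain-to-internal-variable mapping `ε ↦ q`
obtained by inverting `q + (1/(κ f(ε)))·P[q] = (r - e·ε)/(κ f(ε))`. -/
theorem stmt_17 (T κ e f₀ M M₁ : ℝ) (hT : 0 < T) (hκ : 0 < κ) (hf₀ : 0 < f₀)
    (g : ℝ → ℝ → ℝ) (μ : ℝ → ℝ) (hg : IsPreisachDensity g μ)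
    (hM : M = ∫ ρ in Ioi (0:ℝ), μ ρ)
    (hgbdd : ∀ᵐ ρ ∂(volume.restrict (Ioi (0:ℝ))),
      BddAbove (Set.range (g ρ)) ∧ BddBelow (Set.range (g ρ)))
    (hoscint : IntegrableOn
      (fun ρ => sSup (Set.range (g ρ)) - sInf (Set.range (g ρ))) (Ioi 0))
    (hM₁ : M₁ = ∫ ρ in Ioi (0:ℝ), (sSup (Set.range (g ρ)) - sInf (Set.range (g ρ))))
    (r : ℝ → ℝ) (hr : ContinuousOn r (Icc 0 T))
    (f : ℝ → ℝ) (hf : ∀ x, f₀ ≤ f x)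
    (L₁ L₂ : NNReal)
    (hL₁ : LipschitzWith L₁ (fun x => 1 / f x))
    (hL₂ : LipschitzWith L₂ (fun x => x / f x))
    (ε₁ ε₂ : ℝ → ℝ)
    (hε₁ : ContinuousOn ε₁ (Icc 0 T)) (hε₂ : ContinuousOn ε₂ (Icc 0 T))
    (q₁ q₂ q₁' q₂' : ℝ → ℝ) (hq₁ : IsACOn T q₁ q₁') (hq₂ : IsACOn T q₂ q₂')
    (ξ₁ ξ₂ : ℝ → ℝ → ℝ)
    (hξ₁ : ∀ ρ : ℝ, 0 < ρ → ∃ d, IsPlaySol T ρ q₁ (ξ₁ ρ) d)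
    (hξ₂ : ∀ ρ : ℝ, 0 < ρ → ∃ d, IsPlaySol T ρ q₂ (ξ₂ ρ) d)
    (heq₁ : ∀ t ∈ Icc 0 T,
      q₁ t + (1 / (κ * f (ε₁ t))) * (∫ ρ in Ioi (0:ℝ), g ρ (ξ₁ ρ t)) =
        (r t - e * ε₁ t) / (κ * f (ε₁ t)))
    (heq₂ : ∀ t ∈ Icc 0 T,
      q₂ t + (1 / (κ * f (ε₂ t))) * (∫ ρ in Ioi (0:ℝ), g ρ (ξ₂ ρ t)) =
        (r t - e * ε₂ t) / (κ * f (ε₂ t))) :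
    (⨆ t : Icc (0:ℝ) T, |q₁ t - q₂ t|) ≤
      Real.exp (M / (κ * f₀)) * (1 / κ) *
        (((⨆ t : Icc (0:ℝ) T, |r t|) + M₁) * (L₁ : ℝ) + |e| * (L₂ : ℝ)) *
        ⨆ t : Icc (0:ℝ) T, |ε₁ t - ε₂ t| := by
  have hT0 : (0 : ℝ) ∈ Icc 0 T := ⟨le_rfl, hT.le⟩
  have hne : Nonempty (Icc (0:ℝ) T) := ⟨⟨0, hT0⟩⟩
  have hκf : ∀ x, 0 < κ * f x := fun x => mul_pos hκ (hf₀.trans_le (hf x))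
  set W := 1 / (κ * f₀)
  set R := ⨆ t : Icc (0:ℝ) T, |r t|
  set D := ⨆ t : Icc (0:ℝ) T, |ε₁ t - ε₂ t|
  have hR : ∀ t ∈ Icc 0 T, |r t| ≤ R := fun t ht => abs_le_iSup_Icc hr ht
  have hD : ∀ t ∈ Icc 0 T, |ε₁ t - ε₂ t| ≤ D := fun t ht => abs_le_iSup_Icc (hε₁.sub hε₂) ht
  have hD0 : 0 ≤ D := (abs_nonneg _).trans (hD 0 hT0)
  set H := 1 / κ * ((R + M₁) * L₁ + |e| * L₂) * D
  have hi₁ : ∀ t ∈ Icc 0 T, IntegrableOn (fun ρ => g ρ (ξ₁ ρ t)) (Ioi 0) := fun t ht =>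
    hg.integrableOn_comp hgbdd hoscint (IsPlaySol.continuousOn_threshold hξ₁ ht)
  have hi₂ : ∀ t ∈ Icc 0 T, IntegrableOn (fun ρ => g ρ (ξ₂ ρ t)) (Ioi 0) := fun t ht =>
    hg.integrableOn_comp hgbdd hoscint (IsPlaySol.continuousOn_threshold hξ₂ ht)
  have hP : ∀ t, |∫ ρ in Ioi (0:ℝ), g ρ (ξ₂ ρ t)| ≤ M₁ := fun t => by
    rw [hM₁, ← Real.norm_eq_abs]
    exact norm_integral_le_of_norm_le hoscint
      (ae_abs_le_oscillation hg hgbdd fun ρ => ξ₂ ρ t)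
  have hw : ∀ t ∈ Icc 0 T, 0 ≤ 1 / (κ * f (ε₁ t)) ∧ 1 / (κ * f (ε₁ t)) ≤ W := fun t _ =>
    ⟨(one_div_pos.mpr (hκf _)).le, one_div_le_one_div_of_le (mul_pos hκ hf₀)
      (mul_le_mul_of_nonneg_left (hf _) hκ.le)⟩
  have hW : 0 ≤ W := (hw 0 hT0).1.trans (hw 0 hT0).2
  have hres : ∀ t ∈ Icc 0 T, |q₁ t - q₂ t + 1 / (κ * f (ε₁ t)) *
      ((∫ ρ in Ioi (0:ℝ), g ρ (ξ₁ ρ t)) - ∫ ρ in Ioi (0:ℝ), g ρ (ξ₂ ρ t))| ≤ H := by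
    intro t ht
    have e₁ := heq₁ t ht
    have e₂ := heq₂ t ht
    have hP₂ := hP t
    set P₁ := ∫ ρ in Ioi (0:ℝ), g ρ (ξ₁ ρ t)
    set P₂ := ∫ ρ in Ioi (0:ℝ), g ρ (ξ₂ ρ t)
    have hsplit : q₁ t - q₂ t + 1 / (κ * f (ε₁ t)) * (P₁ - P₂) =
        1 / κ * ((r t - P₂) * (1 / f (ε₁ t) - 1 / f (ε₂ t)) -
          e * (ε₁ t / f (ε₁ t) - ε₂ t / f (ε₂ t))) := by
      have n₁ := (hf₀.trans_le (hf (ε₁ t))).ne'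
      have n₂ := (hf₀.trans_le (hf (ε₂ t))).ne'
      have e₁' : q₁ t = (r t - e * ε₁ t) / (κ * f (ε₁ t)) - 1 / (κ * f (ε₁ t)) * P₁ := by
        linarith
      have e₂' : q₂ t = (r t - e * ε₂ t) / (κ * f (ε₂ t)) - 1 / (κ * f (ε₂ t)) * P₂ := by
        linarith
      rw [e₁', e₂']
      field_simp
      ring
    have l₁ : |1 / f (ε₁ t) - 1 / f (ε₂ t)| ≤ L₁ * D :=
      (hL₁.dist_le_mul (ε₁ t) (ε₂ t)).trans (mul_le_mul_of_nonneg_left (hD t ht) L₁.2)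
    have l₂ : |ε₁ t / f (ε₁ t) - ε₂ t / f (ε₂ t)| ≤ L₂ * D :=
      (hL₂.dist_le_mul (ε₁ t) (ε₂ t)).trans (mul_le_mul_of_nonneg_left (hD t ht) L₂.2)
    have l₃ : |r t - P₂| ≤ R + M₁ := (abs_sub _ _).trans (add_le_add (hR t ht) hP₂)
    rw [hsplit, abs_mul, abs_of_pos (one_div_pos.mpr hκ)]
    calc 1 / κ * |(r t - P₂) * (1 / f (ε₁ t) - 1 / f (ε₂ t)) -
          e * (ε₁ t / f (ε₁ t) - ε₂ t / f (ε₂ t))|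
        ≤ 1 / κ * ((R + M₁) * (L₁ * D) + |e| * (L₂ * D)) := by
          refine mul_le_mul_of_nonneg_left ((abs_sub _ _).trans ?_) (one_div_pos.mpr hκ).le
          rw [abs_mul, abs_mul]
          exact add_le_add (mul_le_mul l₃ l₁ (abs_nonneg _) ((abs_nonneg _).trans l₃))
            (mul_le_mul_of_nonneg_left l₂ (abs_nonneg _))
      _ = H := by ring
  have hH : 0 ≤ H := (abs_nonneg _).trans (hres 0 hT0)
  let ν : ℝ → ℝ := (Ioi 0).indicator fun ρ => W * max (μ ρ) 0
  have hν : Integrable ν :=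
    (integrable_indicator_iff measurableSet_Ioi).mpr (hg.2.1.pos_part.const_mul W)
  have hν0 : ∀ x, 0 ≤ ν x :=
    indicator_nonneg fun x _ => mul_nonneg hW (le_max_right _ _)
  have hνint : ∫ ρ in Ioi (0:ℝ), ν ρ = M / (κ * f₀) := by
    have : ∫ ρ in Ioi (0:ℝ), ν ρ = ∫ ρ in Ioi (0:ℝ), W * μ ρ := by
      refine integral_congr_ae ?_
      filter_upwards [hg.2.2, ae_restrict_mem measurableSet_Ioi] with ρ h hρ
      simp only [ν, indicator_of_mem hρ, max_eq_left h.2.1]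
    rw [this, integral_const_mul, ← hM]
    ring
  have hlip : ∀ᵐ ρ ∂(volume.restrict (Ioi (0:ℝ))),
      Monotone (g ρ) ∧ ∀ u v, W * |g ρ u - g ρ v| ≤ ν ρ * |u - v| := by
    filter_upwards [hg.2.2, ae_restrict_mem measurableSet_Ioi] with ρ h hρ
    refine ⟨h.2.2.1, fun u v => ?_⟩
    simp only [ν, indicator_of_mem hρ]
    rw [mul_assoc]
    exact mul_le_mul_of_nonneg_left (h.2.2.2.dist_le_mul u v) hW
  have hC : ∀ t ∈ Icc 0 T, |q₁ t - q₂ t| ≤ ⨆ t : Icc (0:ℝ) T, |q₁ t - q₂ t| :=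
    fun t ht => abs_le_iSup_Icc (hq₁.continuousOn.sub hq₂.continuousOn) ht
  suffices h : ∀ t ∈ Icc 0 T, |q₁ t - q₂ t| ≤ Real.exp (M / (κ * f₀)) * H by
    refine (ciSup_le fun s : Icc (0:ℝ) T => h s s.2).trans (le_of_eq ?_)
    ring
  intro t ht
  refine le_of_forall_pos_le_add fun δ hδ => ?_
  have hx := play_abs_sub_le_mul_expTail hT.le hC hξ₁ hξ₂ hν hν0 hlip hi₁ hi₂ hw hres
    (half_pos hδ) ht
  have hx' := mul_le_mul_of_nonneg_left (expTail_le hν hν0 (half_pos hδ).le) hH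
  rw [hνint] at hx'
  obtain ⟨d₁, hd₁⟩ := hξ₁ _ (half_pos hδ)
  obtain ⟨d₂, hd₂⟩ := hξ₂ _ (half_pos hδ)
  have a₁ := abs_le.mp (hd₁.2.1 t ht)
  have a₂ := abs_le.mp (hd₂.2.1 t ht)
  have a₃ := abs_le.mp (hx.trans hx')
  exact abs_le.mpr ⟨by linarith, by linarith⟩
end
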